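/- Let B be a self-adjoint trace-class operator on a separable Hilbert space H such that Id - B is invertible, and let e ∈ H be a unit vector with orthogonal projection P onto the orthogonal complement of e. Then ⟨e, (Id - B)^{-1} e⟩ = det(Id - P B P) / det(Id - B), where det denotes the Fredholm determinant. -/

import Mathlib

open scoped RealInnerProductSpace Classical

/-- The orthogonal projection onto the orthogonal complement of `e`,
`P = Id - e ⊗ e` (for a unit vector `e`). -/
noncomputable def projPerp {H : Type*} [NormedAddCommGroup H] [InnerProductSpace ℝ H]
    (e : H) : H →L[ℝ] H :=
  ContinuousLinearMap.id ℝ H - (innerSL ℝ e).smulRight e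

/-- `B` is trace-class and self-adjoint, witnessed by a spectral decomposition in a
Hilbert basis of eigenvectors with absolutely summable eigenvalues. -/
def IsTraceClassDiag {H : Type*} [NormedAddCommGroup H] [InnerProductSpace ℝ H]
    (B : H →L[ℝ] H) : Prop :=
  ∃ p : HilbertBasis ℕ ℝ H × (ℕ → ℝ),
    (∀ i, B (p.1 i) = p.2 i • p.1 i) ∧ Summable fun i => |p.2 i|

/-- The Fredholm determinant `det(Id - B) = ∏ᵢ (1 - μᵢ)` over the eigenvalues `μᵢ`
of a (self-adjoint, trace-class) operator `B`; junk value `0` otherwise. -/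
noncomputable def fredholmDet {H : Type*} [NormedAddCommGroup H] [InnerProductSpace ℝ H]
    (B : H →L[ℝ] H) : ℝ :=
  if h : IsTraceClassDiag B then ∏' i, (1 - h.choose.2 i) else 0

section Diagonal

variable {H : Type*} [NormedAddCommGroup H] [InnerProductSpace ℝ H]

lemma HilbertBasis.hasSum_inner_sq {ι : Type*} (b : HilbertBasis ι ℝ H) (x : H) :
    HasSum (fun i => ⟪b i, x⟫ ^ 2) (‖x‖ ^ 2) := by
  have h := b.hasSum_inner_mul_inner x x
  rw [real_inner_self_eq_norm_sq] at h
  refine h.congr_fun fun i => ?_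
  rw [real_inner_comm x (b i), sq]

variable {B : H →L[ℝ] H} {b : HilbertBasis ℕ ℝ H} {μ : ℕ → ℝ}

lemma hasSum_apply_of_diagonal (hB : ∀ i, B (b i) = μ i • b i) (x : H) :
    HasSum (fun i => (μ i * ⟪b i, x⟫) • b i) (B x) := by
  have h := (b.hasSum_repr x).mapL B
  refine h.congr_fun fun i => ?_
  rw [map_smul, hB, smul_smul, b.repr_apply_apply, mul_comm]

lemma hasSum_inner_of_diagonal (hB : ∀ i, B (b i) = μ i • b i) (x : H) :
    HasSum (fun i => μ i * ⟪b i, x⟫ ^ 2) ⟪x, B x⟫ := by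
  have h := (hasSum_apply_of_diagonal hB x).mapL (innerSL ℝ x)
  refine h.congr_fun fun i => ?_
  simp only [innerSL_apply_apply, inner_smul_right, real_inner_comm x (b i)]
  ring

lemma isCompactOperator_of_diagonal [CompleteSpace H] (hB : ∀ i, B (b i) = μ i • b i)
    (hμ : Summable fun i => |μ i|) : IsCompactOperator B := by
  have hs : Summable fun i => μ i • (innerSL ℝ (b i)).smulRight (b i) := by
    refine Summable.of_norm_bounded hμ fun i => ?_
    rw [norm_smul, ContinuousLinearMap.norm_smulRight_apply, innerSL_apply_norm,
      b.orthonormal.1 i]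
    simp
  have hsum : HasSum (fun i => μ i • (innerSL ℝ (b i)).smulRight (b i)) B := by
    convert hs.hasSum
    ext x
    have h := hs.hasSum.mapL (ContinuousLinearMap.apply ℝ H x)
    refine (hasSum_apply_of_diagonal hB x).unique (h.congr_fun fun i => ?_)
    simp [smul_smul]
  refine isCompactOperator_of_tendsto hsum (Filter.Eventually.of_forall fun s => ?_)
  refine (compactOperator (RingHom.id ℝ) H H).sum_mem fun i _ => ?_
  refine (compactOperator (RingHom.id ℝ) H H).smul_mem _ ?_
  exact (isCompactOperator_of_locallyCompactSpace_rng
    (ContinuousLinearMap.toSpanSingleton ℝ (b i))).comp_clm (innerSL ℝ (b i))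

lemma hasSum_tsum_mul_inner_sq {a : ℕ → H} (hμ : Summable fun i => |μ i|)
    (ha : ∀ i, ‖a i‖ ≤ 1) (f : HilbertBasis ℕ ℝ H) :
    HasSum (fun k => ∑' i, μ i * ⟪a i, f k⟫ ^ 2) (∑' i, μ i * ‖a i‖ ^ 2) := by
  have hrow (c : ℝ) (i : ℕ) : HasSum (fun k => c * ⟪a i, f k⟫ ^ 2) (c * ‖a i‖ ^ 2) :=
    ((f.hasSum_inner_sq (a i)).congr_fun fun k => by rw [real_inner_comm]).mul_left c
  have hs : Summable fun p : ℕ × ℕ => μ p.1 * ⟪a p.1, f p.2⟫ ^ 2 := by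
    refine Summable.of_norm ?_
    simp only [norm_mul, Real.norm_eq_abs, abs_pow, sq_abs]
    refine (summable_prod_of_nonneg fun p => by positivity).2
      ⟨fun i => (hrow |μ i| i).summable, ?_⟩
    simp only [(hrow _ _).tsum_eq]
    refine hμ.of_nonneg_of_le (fun i => by positivity) fun i => ?_
    exact mul_le_of_le_one_right (abs_nonneg _) (pow_le_one₀ (norm_nonneg _) (ha i))
  have hcomm : ∑' k, ∑' i, μ i * ⟪a i, f k⟫ ^ 2 = ∑' i, μ i * ‖a i‖ ^ 2 :=
    (Summable.tsum_comm (f := fun i k => μ i * ⟪a i, f k⟫ ^ 2) hs).trans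
      (tsum_congr fun i => (hrow (μ i) i).tsum_eq)
  rw [← hcomm]
  exact (Summable.prod (f := fun p : ℕ × ℕ => μ p.2 * ⟪a p.2, f p.1⟫ ^ 2) hs.prod_symm).hasSum

lemma hasSum_inner_diagonal (hB : ∀ i, B (b i) = μ i • b i)
    (hμ : Summable fun i => |μ i|) (f : HilbertBasis ℕ ℝ H) :
    HasSum (fun k => ⟪f k, B (f k)⟫) (∑' i, μ i) := by
  have h := hasSum_tsum_mul_inner_sq hμ (fun i => (b.orthonormal.1 i).le) f
  simp only [(hasSum_inner_of_diagonal hB _).tsum_eq, b.orthonormal.1, one_pow, mul_one] at h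
  exact h

lemma isUnit_sub_eigenvalue_ne_zero (hB : ∀ i, B (b i) = μ i • b i) {t : ℝ}
    (hu : IsUnit (1 - t • B)) (i : ℕ) : 1 - t * μ i ≠ 0 := by
  intro h
  obtain ⟨u, hu⟩ := hu
  have h₁ : (u : H →L[ℝ] H) (b i) = 0 := by
    rw [hu]
    simp only [_root_.sub_apply, one_apply_eq_self,
      _root_.smul_apply, hB, smul_smul]
    rw [← sub_eq_zero.1 h, one_smul, sub_self]
  have h₂ : (↑u⁻¹ * ↑u : H →L[ℝ] H) (b i) = 0 := by
    rw [mul_apply_eq_comp, h₁, map_zero]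
  rw [Units.inv_mul] at h₂
  exact b.orthonormal.ne_zero i h₂

lemma inverse_apply_eq {T : H →L[ℝ] H} (hT : IsUnit T) {x y : H} (h : T x = y) :
    Ring.inverse T y = x := by
  rw [← h, ← mul_apply_eq_comp, Ring.inverse_mul_cancel _ hT,
    one_apply_eq_self]

lemma apply_inverse {T : H →L[ℝ] H} (hT : IsUnit T) (x : H) : T (Ring.inverse T x) = x := by
  rw [← mul_apply_eq_comp, Ring.mul_inverse_cancel _ hT,
    one_apply_eq_self]

lemma inverse_one_sub_diagonal (hB : ∀ i, B (b i) = μ i • b i) {t : ℝ}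
    (hu : IsUnit (1 - t • B)) (i : ℕ) :
    Ring.inverse (1 - t • B) (b i) = (1 - t * μ i)⁻¹ • b i := by
  refine inverse_apply_eq hu ?_
  rw [map_smul]
  simp only [_root_.sub_apply, one_apply_eq_self,
      _root_.smul_apply, hB, smul_smul]
  nth_rewrite 1 [← one_smul ℝ (b i)]
  rw [← sub_smul, smul_smul, inv_mul_cancel₀ (isUnit_sub_eigenvalue_ne_zero hB hu i), one_smul]

end Diagonal

section Spectral

variable {H : Type*} [NormedAddCommGroup H] [InnerProductSpace ℝ H] [CompleteSpace H]

/-- A compact self-adjoint operator has a Hilbert basis of eigenvectors, indexed by `ℕ` as soon as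
the space has some Hilbert basis indexed by `ℕ`. -/
lemma exists_hilbertBasis_eigenvectors {T : H →L[ℝ] H} (hT : IsCompactOperator T)
    (hT' : (T : H →ₗ[ℝ] H).IsSymmetric) (b : HilbertBasis ℕ ℝ H) :
    ∃ (f : HilbertBasis ℕ ℝ H) (ν : ℕ → ℝ), ∀ k, T (f k) = ν k • f k := by
  let E : ℝ → Submodule ℝ H := fun μ => Module.End.eigenspace (T : Module.End ℝ H) μ
  have hE : ∀ μ, IsClosed (E μ : Set H) := fun μ => by
    have h : (E μ : Set H) = {x | T x = μ • x} := by
      ext x; simp [E]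
    rw [h]
    exact isClosed_eq T.continuous (continuous_const_smul μ)
  have : ∀ μ, CompleteSpace (E μ) := fun μ => (hE μ).completeSpace_coe
  choose w c hc using fun μ => exists_hilbertBasis ℝ (E μ)
  let v : (Σ μ, w μ) → H := fun a => (c a.1 a.2 : H)
  have hv : Orthonormal ℝ v :=
    hT'.orthogonalFamily_eigenspaces.orthonormal_sigma_orthonormal fun μ => (c μ).orthonormal
  have hTv : ∀ a, T (v a) = a.1 • v a := fun a =>
    Module.End.mem_eigenspace_iff.1 (c a.1 a.2).2
  have hspan : (Submodule.span ℝ (Set.range v))ᗮ = ⊥ := by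
    rw [eq_bot_iff, ← ContinuousLinearMap.orthogonalComplement_iSup_eigenspaces_eq_bot hT hT']
    intro x hx
    rw [Submodule.mem_orthogonal'] at hx
    have hμ : ∀ μ, E μ ≤ (ℝ ∙ x)ᗮ := fun μ y hy => by
      have h := ((c μ).hasSum_repr ⟨y, hy⟩).mapL (E μ).subtypeL
      have h' := h.mapL (innerSL ℝ x)
      rw [Submodule.mem_orthogonal_singleton_iff_inner_right]
      refine h'.unique (hasSum_zero.congr_fun fun i => ?_)
      have : ⟪x, v ⟨μ, i⟩⟫ = 0 := hx _ (Submodule.subset_span ⟨_, rfl⟩)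
      simp [v] at this ⊢
      exact Or.inr this
    rw [Submodule.mem_orthogonal']
    intro y hy
    exact Submodule.mem_orthogonal_singleton_iff_inner_right.1 (iSup_le hμ hy)
  have hcount : Countable (Σ μ, w μ) := by
    have h : (Set.univ : Set (Σ μ, w μ)) ⊆ ⋃ i, Function.support fun a => ⟪v a, b i⟫ ^ 2 := by
      intro a _
      by_contra hcon
      simp only [Set.mem_iUnion, Function.mem_support, not_exists, not_not] at hcon
      have h0 : ‖v a‖ ^ 2 = 0 := (b.hasSum_inner_sq (v a)).unique
        (hasSum_zero.congr_fun fun i => by rw [real_inner_comm]; exact hcon i)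
      rw [hv.1 a] at h0
      norm_num at h0
    refine Set.countable_univ_iff.1 (Set.Countable.mono h (Set.countable_iUnion fun i => ?_))
    have hs := (HilbertBasis.mkOfOrthogonalEqBot hv hspan).hasSum_inner_sq (b i)
    rw [HilbertBasis.coe_mkOfOrthogonalEqBot] at hs
    exact hs.summable.countable_support
  have hinf : Infinite (Σ μ, w μ) := by
    by_contra hfin
    rw [not_infinite_iff_finite] at hfin
    have : FiniteDimensional ℝ (Submodule.span ℝ (Set.range v)) :=
      FiniteDimensional.span_of_finite ℝ (Set.finite_range v)
    have htop : Submodule.span ℝ (Set.range v) = ⊤ := by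
      rw [← Submodule.orthogonal_eq_bot_iff, hspan]
    rw [htop] at this
    have : FiniteDimensional ℝ H := Module.finite_def.2 (Module.Finite.iff_fg.1 this)
    exact not_finite_iff_infinite.2 inferInstance b.orthonormal.linearIndependent.finite
  obtain ⟨φ⟩ : Nonempty (ℕ ≃ Σ μ, w μ) := nonempty_equiv_of_countable
  refine ⟨HilbertBasis.mkOfOrthogonalEqBot (hv.comp φ φ.injective) ?_, fun k => (φ k).1,
    fun k => ?_⟩
  · rw [φ.surjective.range_comp, hspan]
  · rw [HilbertBasis.coe_mkOfOrthogonalEqBot]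
    exact hTv _

end Spectral

section EntireDeterminant

/-- The entire function `z ↦ ∏ᵢ (1 - z μᵢ)` attached to a summable sequence `μ`. -/
noncomputable def charProd (μ : ℕ → ℝ) (z : ℂ) : ℂ :=
  ∏' i, (1 - z * μ i)

variable {μ : ℕ → ℝ}

lemma charProd_zero (μ : ℕ → ℝ) : charProd μ 0 = 1 := by
  simp [charProd]

lemma summable_norm_neg_mul (hμ : Summable fun i => |μ i|) (z : ℂ) :
    Summable fun i => ‖-(z * μ i)‖ := by
  simpa using hμ.mul_left ‖z‖

lemma multipliable_charProd (hμ : Summable fun i => |μ i|) (z : ℂ) :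
    Multipliable fun i => 1 - z * μ i := by
  simpa only [← sub_eq_add_neg] using multipliable_one_add_of_summable (summable_norm_neg_mul hμ z)

lemma charProd_ofReal (hμ : Summable fun i => |μ i|) (t : ℝ) :
    charProd μ t = ((∏' i, (1 - t * μ i) : ℝ) : ℂ) := by
  have hm : Multipliable fun i => 1 - t * μ i := by
    have h : Summable fun i => ‖-(t * μ i)‖ := by simpa [abs_mul] using hμ.mul_left |t|
    simpa only [← sub_eq_add_neg] using multipliable_one_add_of_summable h
  have h := hm.hasProd.map Complex.ofRealHom Complex.continuous_ofReal
  refine HasProd.tprod_eq ?_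
  convert h using 1
  · funext i
    simp
  · rfl

lemma charProd_ne_zero (hμ : Summable fun i => |μ i|) {z : ℂ} (hz : ∀ i, 1 - z * μ i ≠ 0) :
    charProd μ z ≠ 0 := by
  unfold charProd
  have h := tprod_one_add_ne_zero_of_summable (f := fun i => -(z * μ i))
    (fun i => by simpa only [← sub_eq_add_neg] using hz i) (summable_norm_neg_mul hμ z)
  simpa only [← sub_eq_add_neg] using h

lemma norm_charProd_le (hμ : Summable fun i => |μ i|) (z : ℂ) :
    ‖charProd μ z‖ ≤ Real.exp (‖z‖ * ∑' i, |μ i|) := by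
  refine le_of_tendsto (multipliable_charProd hμ z).hasProd.norm
    (Filter.Eventually.of_forall fun s => ?_)
  calc ∏ i ∈ s, ‖1 - z * μ i‖ ≤ ∏ i ∈ s, (1 + ‖z‖ * |μ i|) := by
        refine Finset.prod_le_prod (fun i _ => norm_nonneg _) fun i _ => ?_
        simpa using norm_sub_le (1 : ℂ) (z * μ i)
    _ ≤ Real.exp (∑ i ∈ s, ‖z‖ * |μ i|) :=
        Real.prod_one_add_le_exp_sum _ fun i => by positivity
    _ ≤ Real.exp (‖z‖ * ∑' i, |μ i|) := by
        rw [Real.exp_le_exp, ← Finset.mul_sum]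
        exact mul_le_mul_of_nonneg_left (hμ.sum_le_tsum s fun i _ => abs_nonneg _) (norm_nonneg _)

lemma hasProdLocallyUniformlyOn_charProd (hμ : Summable fun i => |μ i|) (r : ℝ) :
    HasProdLocallyUniformlyOn (fun i z => 1 - z * (μ i : ℂ)) (charProd μ) (Metric.ball 0 r) := by
  have hdef : charProd μ = fun z => ∏' i, (1 - z * (μ i : ℂ)) := rfl
  rw [hdef]
  have h := Summable.hasProdLocallyUniformlyOn_one_add (f := fun i (z : ℂ) => -(z * (μ i : ℂ)))
    (u := fun i => r * |μ i|) Metric.isOpen_ball (hμ.mul_left r)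
    (Filter.Eventually.of_forall fun i z hz => by
      rw [mem_ball_zero_iff] at hz
      simpa using mul_le_mul_of_nonneg_right hz.le (abs_nonneg (μ i)))
    (fun i => by fun_prop)
  simpa only [← sub_eq_add_neg] using h

lemma differentiable_charProd (hμ : Summable fun i => |μ i|) :
    Differentiable ℂ (charProd μ) := fun z => by
  have h := (hasProdLocallyUniformlyOn_charProd hμ (‖z‖ + 1)).differentiableOn
    (Filter.Eventually.of_forall fun s => DifferentiableOn.fun_finsetProd fun i _ => by fun_prop)
    Metric.isOpen_ball
  exact h.differentiableAt (Metric.isOpen_ball.mem_nhds (by simp))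

lemma summable_div_one_sub (hμ : Summable fun i => |μ i|) (t : ℝ) :
    Summable fun i => |μ i / (1 - t * μ i)| := by
  refine Summable.of_norm_bounded_eventually (hμ.mul_left 2) ?_
  have hlim : Filter.Tendsto (fun i => |1 - t * μ i|) Filter.cofinite (nhds |1 - t * 0|) :=
    ((hμ.of_abs.tendsto_cofinite_zero.const_mul t).const_sub 1).abs
  have h2 := hlim.eventually (lt_mem_nhds (show (1 / 2 : ℝ) < |1 - t * 0| by norm_num))
  filter_upwards [h2] with i hi
  rw [Real.norm_eq_abs, abs_abs, abs_div, div_le_iff₀ (by linarith)]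
  nlinarith [abs_nonneg (μ i)]

lemma hasDerivAt_charProd (hμ : Summable fun i => |μ i|) {t : ℝ} (ht : ∀ i, 1 - t * μ i ≠ 0) :
    HasDerivAt (charProd μ) (-((∑' i, μ i / (1 - t * μ i) : ℝ) : ℂ) * charProd μ t) (t : ℂ) := by
  have hne : ∀ i, (1 - (t : ℂ) * μ i) ≠ 0 := fun i => mod_cast ht i
  have hlog : ∀ i, logDeriv (fun z : ℂ => 1 - z * μ i) t = -((μ i / (1 - t * μ i) : ℝ) : ℂ) := by
    intro i
    have hd : HasDerivAt (fun z : ℂ => 1 - z * μ i) (-(1 * (μ i : ℂ))) t :=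
      ((hasDerivAt_id _).mul_const _).const_sub 1
    rw [logDeriv_apply, hd.deriv]
    push_cast
    ring
  have hs : Summable fun i => -((μ i / (1 - t * μ i) : ℝ) : ℂ) :=
    (Complex.summable_ofReal.2 (summable_div_one_sub hμ t).of_abs).neg
  have h := logDeriv_tprod_eq_tsum (f := fun i z => 1 - z * (μ i : ℂ)) (s := Metric.ball 0 (|t| + 1))
    Metric.isOpen_ball (x := (t : ℂ)) (by simp) hne (fun i => by fun_prop)
    (by simpa only [hlog] using hs)
    (hasProdLocallyUniformlyOn_charProd hμ _).multipliableLocallyUniformlyOn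
    (charProd_ne_zero hμ hne)
  simp only [hlog, tsum_neg, ← Complex.ofReal_tsum] at h
  have h' : deriv (charProd μ) t / charProd μ t = -((∑' i, μ i / (1 - t * μ i) : ℝ) : ℂ) := h
  rw [← h', div_mul_cancel₀ _ (charProd_ne_zero hμ hne)]
  exact (differentiable_charProd hμ t).hasDerivAt

lemma summable_abs_update (hμ : Summable fun i => |μ i|) (i : ℕ) :
    Summable fun j => |Function.update μ i 0 j| := by
  refine hμ.of_nonneg_of_le (fun j => abs_nonneg _) fun j => ?_
  by_cases h : j = i
  · subst h; simp
  · simp [h]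

lemma charProd_eq_mul_update (hμ : Summable fun i => |μ i|) (i : ℕ) (z : ℂ) :
    charProd μ z = (1 - z * μ i) * charProd (Function.update μ i 0) z := by
  have h₁ := (multipliable_charProd hμ z).hasProd
  have h₂ : HasProd _ (charProd (Function.update μ i 0) z) :=
    (multipliable_charProd (summable_abs_update hμ i) z).hasProd
  have h := h₁.update' i 1 (a' := charProd (Function.update μ i 0) z) (by
    convert h₂ using 1
    funext j
    by_cases h : j = i
    · subst h; simp
    · simp [h])
  rw [mul_one, mul_comm] at h
  exact h

lemma differentiable_tsum_mul_charProd_update (hμ : Summable fun i => |μ i|) {w : ℕ → ℝ}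
    (hw : Summable fun i => |w i|) :
    Differentiable ℂ fun z => ∑' i, (w i : ℂ) * charProd (Function.update μ i 0) z := fun z => by
  have h := Complex.differentiableOn_tsum_of_summable_norm (U := Metric.ball (0 : ℂ) (‖z‖ + 1))
    (F := fun i z => (w i : ℂ) * charProd (Function.update μ i 0) z)
    (hw.mul_right (Real.exp ((‖z‖ + 1) * ∑' i, |μ i|)))
    (fun i => ((differentiable_charProd (summable_abs_update hμ i)).const_mul _).differentiableOn)
    Metric.isOpen_ball (fun i x hx => by
      rw [norm_mul, Complex.norm_real, Real.norm_eq_abs]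
      refine mul_le_mul_of_nonneg_left ?_ (abs_nonneg _)
      refine (norm_charProd_le (summable_abs_update hμ i) x).trans (Real.exp_le_exp.2 ?_)
      rw [mem_ball_zero_iff] at hx
      refine mul_le_mul hx.le ?_ (tsum_nonneg fun _ => abs_nonneg _) (by positivity)
      refine (summable_abs_update hμ i).tsum_le_tsum (fun j => ?_) hμ
      by_cases h : j = i
      · subst h; simp
      · simp [h])
  exact h.differentiableAt (Metric.isOpen_ball.mem_nhds (by simp))

lemma tsum_mul_charProd_update (hμ : Summable fun i => |μ i|) (w : ℕ → ℝ) {t : ℝ}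
    (ht : ∀ i, 1 - t * μ i ≠ 0) :
    ∑' i, (w i : ℂ) * charProd (Function.update μ i 0) t =
      charProd μ t * ((∑' i, (1 - t * μ i)⁻¹ * w i : ℝ) : ℂ) := by
  rw [Complex.ofReal_tsum, ← tsum_mul_left]
  refine tsum_congr fun i => ?_
  have hne : (1 - (t : ℂ) * μ i) ≠ 0 := mod_cast ht i
  rw [charProd_eq_mul_update hμ i t]
  push_cast
  field_simp

end EntireDeterminant

section RankOne

variable {H : Type*} [NormedAddCommGroup H] [InnerProductSpace ℝ H]

lemma projPerp_apply (e x : H) : projPerp e x = x - ⟪e, x⟫ • e := by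
  simp [projPerp]

lemma inner_projPerp_left (e x y : H) : ⟪projPerp e x, y⟫ = ⟪x, projPerp e y⟫ := by
  simp only [projPerp_apply, inner_sub_left, inner_sub_right, inner_smul_left, inner_smul_right,
    real_inner_comm e x]
  simp
  ring

lemma norm_projPerp_sq {e : H} (he : ‖e‖ = 1) (x : H) :
    ‖projPerp e x‖ ^ 2 = ‖x‖ ^ 2 - ⟪e, x⟫ ^ 2 := by
  rw [projPerp_apply, norm_sub_sq_real, inner_smul_right, norm_smul, he, real_inner_comm e x,
    mul_one, Real.norm_eq_abs, sq_abs]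
  ring

lemma norm_projPerp_le {e : H} (he : ‖e‖ = 1) (x : H) : ‖projPerp e x‖ ≤ ‖x‖ := by
  refine le_of_sq_le_sq ?_ (norm_nonneg _)
  rw [norm_projPerp_sq he]
  linarith [sq_nonneg ⟪e, x⟫]

variable {B : H →L[ℝ] H}

lemma one_sub_smul_apply (t : ℝ) (x : H) : (1 - t • B) x = x - t • B x := rfl

lemma inner_inverse_left (hsym : ∀ f g : H, ⟪B f, g⟫ = ⟪f, B g⟫) {t : ℝ}
    (hu : IsUnit (1 - t • B)) (x y : H) :
    ⟪Ring.inverse (1 - t • B) x, y⟫ = ⟪x, Ring.inverse (1 - t • B) y⟫ := by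
  conv_lhs => rw [← apply_inverse hu y]
  conv_rhs => rw [← apply_inverse hu x]
  simp only [one_sub_smul_apply, inner_sub_left, inner_sub_right, inner_smul_left,
    inner_smul_right, hsym]
  simp

lemma inverse_compression_apply (hsym : ∀ f g : H, ⟪B f, g⟫ = ⟪f, B g⟫) {e : H} (he : ‖e‖ = 1)
    {t : ℝ} (hu : IsUnit (1 - t • B))
    (hu' : IsUnit (1 - t • (projPerp e).comp (B.comp (projPerp e))))
    (hR : ⟪e, Ring.inverse (1 - t • B) e⟫ ≠ 0) (x : H) :
    Ring.inverse (1 - t • (projPerp e).comp (B.comp (projPerp e))) x =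
      Ring.inverse (1 - t • B) x
        - (⟪Ring.inverse (1 - t • B) e, x⟫ / ⟪e, Ring.inverse (1 - t • B) e⟫) •
          Ring.inverse (1 - t • B) e + ⟪e, x⟫ • e := by
  have hKx := apply_inverse hu x
  have hKe := apply_inverse hu e
  have hsymK := inner_inverse_left hsym hu e x
  set K := Ring.inverse (1 - t • B)
  set c := ⟪K e, x⟫ / ⟪e, K e⟫ with hc
  set y := K x - c • K e with hy
  have hey : ⟪e, y⟫ = 0 := by
    rw [hy, inner_sub_right, inner_smul_right, hc, div_mul_cancel₀ _ hR, hsymK, sub_self]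
  have hee : ⟪e, e⟫ = 1 := by rw [real_inner_self_eq_norm_sq, he, one_pow]
  have hP : projPerp e (y + ⟪e, x⟫ • e) = y := by
    rw [projPerp_apply, inner_add_right, hey, inner_smul_right, hee]
    simp
  have hty : t • B y = y - x + c • e := by
    have h : (1 - t • B) y = x - c • e := by rw [hy, map_sub, map_smul, hKx, hKe]
    rw [one_sub_smul_apply] at h
    rw [← sub_sub_cancel y (t • B y), h]
    abel
  refine inverse_apply_eq hu' ?_
  rw [one_sub_smul_apply, ContinuousLinearMap.comp_apply, ContinuousLinearMap.comp_apply, hP,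
    ← map_smul, hty, projPerp_apply, inner_add_right, inner_sub_right, hey, inner_smul_right, hee]
  module

variable {b f : HilbertBasis ℕ ℝ H} {μ ν : ℕ → ℝ}

lemma hasSum_inner_inverse_sub_one (hB : ∀ i, B (b i) = μ i • b i)
    (hμ : Summable fun i => |μ i|) {t : ℝ} (hu : IsUnit (1 - t • B)) (g : HilbertBasis ℕ ℝ H) :
    HasSum (fun k => ⟪g k, Ring.inverse (1 - t • B) (g k)⟫ - 1)
      (t * ∑' i, μ i / (1 - t * μ i)) := by
  have hT : ∀ i, (Ring.inverse (1 - t • B) - 1) (b i) = (t * (μ i / (1 - t * μ i))) • b i := by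
    intro i
    have hne := isUnit_sub_eigenvalue_ne_zero hB hu i
    rw [_root_.sub_apply, inverse_one_sub_diagonal hB hu, one_apply_eq_self]
    nth_rewrite 2 [← one_smul ℝ (b i)]
    rw [← sub_smul]
    congr 1
    field_simp
    ring
  have h := hasSum_inner_diagonal hT
    (by simpa only [abs_mul] using (summable_div_one_sub hμ t).mul_left |t|) g
  rw [tsum_mul_left] at h
  refine h.congr_fun fun k => ?_
  rw [_root_.sub_apply, inner_sub_right, one_apply_eq_self, real_inner_self_eq_norm_sq,
    g.orthonormal.1, one_pow]

lemma mul_tsum_sub_tsum (hsym : ∀ f g : H, ⟪B f, g⟫ = ⟪f, B g⟫) {e : H} (he : ‖e‖ = 1)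
    (hB : ∀ i, B (b i) = μ i • b i) (hμ : Summable fun i => |μ i|)
    (hC : ∀ i, (projPerp e).comp (B.comp (projPerp e)) (f i) = ν i • f i)
    (hν : Summable fun i => |ν i|) {t : ℝ} (hu : IsUnit (1 - t • B))
    (hu' : IsUnit (1 - t • (projPerp e).comp (B.comp (projPerp e))))
    (hR : ⟪e, Ring.inverse (1 - t • B) e⟫ ≠ 0) :
    t * ∑' i, μ i / (1 - t * μ i) - t * ∑' i, ν i / (1 - t * ν i) =
      ‖Ring.inverse (1 - t • B) e‖ ^ 2 / ⟪e, Ring.inverse (1 - t • B) e⟫ - 1 := by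
  have h₁ := (hasSum_inner_inverse_sub_one hB hμ hu f).sub
    (hasSum_inner_inverse_sub_one hC hν hu' f)
  have h₂ := ((f.hasSum_inner_sq (Ring.inverse (1 - t • B) e)).div_const
    ⟪e, Ring.inverse (1 - t • B) e⟫).sub (f.hasSum_inner_sq e)
  rw [he, one_pow] at h₂
  refine h₁.unique (h₂.congr_fun fun k => ?_)
  rw [inverse_compression_apply hsym he hu hu' hR, inner_add_right, inner_sub_right,
    inner_smul_right, inner_smul_right, real_inner_comm (f k) (Ring.inverse (1 - t • B) e),
    real_inner_comm (f k) e]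
  ring

lemma mul_inner_inverse_apply {t : ℝ} (hu : IsUnit (1 - t • B)) (e : H) :
    t * ⟪Ring.inverse (1 - t • B) e, B (Ring.inverse (1 - t • B) e)⟫ =
      ‖Ring.inverse (1 - t • B) e‖ ^ 2 - ⟪e, Ring.inverse (1 - t • B) e⟫ := by
  have hKe := apply_inverse hu e
  set g := Ring.inverse (1 - t • B) e
  rw [one_sub_smul_apply] at hKe
  rw [← inner_smul_right, ← sub_sub_cancel g (t • B g), hKe, inner_sub_right,
    real_inner_self_eq_norm_sq, real_inner_comm]

lemma tsum_mul_charProd_update_eq (hB : ∀ i, B (b i) = μ i • b i)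
    (hμ : Summable fun i => |μ i|) {t : ℝ} (hu : IsUnit (1 - t • B)) (e : H) :
    ∑' i, ((⟪b i, e⟫ ^ 2 : ℝ) : ℂ) * charProd (Function.update μ i 0) t =
      charProd μ t * (⟪e, Ring.inverse (1 - t • B) e⟫ : ℝ) := by
  rw [tsum_mul_charProd_update hμ (fun i => ⟪b i, e⟫ ^ 2) (isUnit_sub_eigenvalue_ne_zero hB hu),
    (hasSum_inner_of_diagonal (inverse_one_sub_diagonal hB hu) e).tsum_eq]

end RankOne

section Resolvent

variable {H : Type*} [NormedAddCommGroup H] [InnerProductSpace ℝ H] [CompleteSpace H]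
  {B : H →L[ℝ] H}

lemma isUnit_one_sub_smul {t : ℝ} (ht : |t| * ‖B‖ < 1) : IsUnit (1 - t • B) :=
  isUnit_one_sub_of_norm_lt_one (by rwa [norm_smul, Real.norm_eq_abs])

lemma inner_inverse_pos {t : ℝ} (ht : |t| * ‖B‖ < 1) {e : H} (he : e ≠ 0) :
    0 < ⟪e, Ring.inverse (1 - t • B) e⟫ := by
  have hKe := apply_inverse (isUnit_one_sub_smul ht) e
  set g := Ring.inverse (1 - t • B) e
  have hg : 0 < ‖g‖ := by
    rw [norm_pos_iff]
    intro h
    rw [h, map_zero] at hKe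
    exact he hKe.symm
  rw [← hKe, one_sub_smul_apply, inner_sub_left, inner_smul_left, real_inner_self_eq_norm_sq]
  have h₁ : |t * ⟪B g, g⟫| ≤ |t| * (‖B‖ * ‖g‖ * ‖g‖) := by
    rw [abs_mul]
    refine mul_le_mul_of_nonneg_left ((abs_real_inner_le_norm _ _).trans ?_) (abs_nonneg _)
    exact mul_le_mul_of_nonneg_right (B.le_opNorm g) (norm_nonneg _)
  have h₂ := (abs_le.1 h₁).2
  have h₃ : 0 < (1 - |t| * ‖B‖) * ‖g‖ ^ 2 := mul_pos (by linarith) (by positivity)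
  simp only [conj_trivial]
  nlinarith

lemma hasDerivAt_inverse_one_sub_smul {t : ℝ} (hu : IsUnit (1 - t • B)) :
    HasDerivAt (fun s : ℝ => Ring.inverse (1 - s • B))
      (Ring.inverse (1 - t • B) * B * Ring.inverse (1 - t • B)) t := by
  have hd : HasDerivAt (fun s : ℝ => 1 - s • B) (-B) t := by
    simpa using ((hasDerivAt_id t).smul_const B).const_sub 1
  obtain ⟨u, hu'⟩ := id hu
  have hinv : HasFDerivAt Ring.inverse
      (-ContinuousLinearMap.mulLeftRight ℝ (H →L[ℝ] H) ↑u⁻¹ ↑u⁻¹) (1 - t • B) :=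
    hu' ▸ hasFDerivAt_ringInverse (𝕜 := ℝ) u
  have h : HasDerivAt (fun s : ℝ => Ring.inverse (1 - s • B))
      ((-ContinuousLinearMap.mulLeftRight ℝ (H →L[ℝ] H) ↑u⁻¹ ↑u⁻¹) (-B)) t :=
    HasFDerivAt.comp_hasDerivAt (l := Ring.inverse) t hinv hd
  rw [← hu', Ring.inverse_unit]
  rw [_root_.neg_apply, map_neg, neg_neg, ContinuousLinearMap.mulLeftRight_apply] at h
  exact h

lemma hasDerivAt_inner_inverse (hsym : ∀ f g : H, ⟪B f, g⟫ = ⟪f, B g⟫) {t : ℝ}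
    (hu : IsUnit (1 - t • B)) (e : H) :
    HasDerivAt (fun s : ℝ => ⟪e, Ring.inverse (1 - s • B) e⟫)
      ⟪Ring.inverse (1 - t • B) e, B (Ring.inverse (1 - t • B) e)⟫ t := by
  have h : HasDerivAt (fun s : ℝ => Ring.inverse (1 - s • B) e)
      ((Ring.inverse (1 - t • B) * B * Ring.inverse (1 - t • B)) e) t :=
    (ContinuousLinearMap.apply ℝ H e).hasFDerivAt.comp_hasDerivAt t
      (hasDerivAt_inverse_one_sub_smul hu)
  have h' : HasDerivAt (fun s : ℝ => ⟪e, Ring.inverse (1 - s • B) e⟫)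
      ⟪e, (Ring.inverse (1 - t • B) * B * Ring.inverse (1 - t • B)) e⟫ t :=
    (innerSL ℝ e).hasFDerivAt.comp_hasDerivAt t h
  rw [inner_inverse_left hsym hu]
  exact h'

end Resolvent

section Cramer

open Filter Topology

variable {H : Type*} [NormedAddCommGroup H] [InnerProductSpace ℝ H] [CompleteSpace H]
  {B : H →L[ℝ] H} {b f : HilbertBasis ℕ ℝ H} {μ ν : ℕ → ℝ}

lemma isTraceClassDiag_compression (hsym : ∀ f g : H, ⟪B f, g⟫ = ⟪f, B g⟫)
    (htc : IsTraceClassDiag B) {e : H} (he : ‖e‖ = 1) :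
    IsTraceClassDiag ((projPerp e).comp (B.comp (projPerp e))) := by
  obtain ⟨⟨b, μ⟩, hB, hμ⟩ := htc
  have hcompact : IsCompactOperator ((projPerp e).comp (B.comp (projPerp e))) :=
    ((isCompactOperator_of_diagonal hB hμ).comp_clm (projPerp e)).clm_comp (projPerp e)
  have hsymm :
      (((projPerp e).comp (B.comp (projPerp e)) : H →L[ℝ] H) : H →ₗ[ℝ] H).IsSymmetric := by
    intro x y
    change ⟪projPerp e (B (projPerp e x)), y⟫ = ⟪x, projPerp e (B (projPerp e y))⟫
    rw [inner_projPerp_left, hsym, inner_projPerp_left]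
  obtain ⟨f, ν, hf⟩ := exists_hilbertBasis_eigenvectors hcompact hsymm b
  refine ⟨(f, ν), hf, ?_⟩
  have h := hasSum_tsum_mul_inner_sq hμ
    (fun i => (norm_projPerp_le he (b i)).trans (b.orthonormal.1 i).le) f
  refine (h.summable.congr fun k => ?_).abs
  have hν : ν k = ⟪f k, (projPerp e).comp (B.comp (projPerp e)) (f k)⟫ := by
    rw [hf, inner_smul_right, real_inner_self_eq_norm_sq, f.orthonormal.1, one_pow, mul_one]
  simp only [hν, inner_projPerp_left]
  rw [ContinuousLinearMap.comp_apply, ContinuousLinearMap.comp_apply, ← inner_projPerp_left]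
  exact (hasSum_inner_of_diagonal hB _).tsum_eq

lemma hasDerivAt_charProd_mul_inner_inverse_div (hsym : ∀ f g : H, ⟪B f, g⟫ = ⟪f, B g⟫)
    {e : H} (he : ‖e‖ = 1) (hB : ∀ i, B (b i) = μ i • b i) (hμ : Summable fun i => |μ i|)
    (hC : ∀ i, (projPerp e).comp (B.comp (projPerp e)) (f i) = ν i • f i)
    (hν : Summable fun i => |ν i|) {t : ℝ} (ht : t ≠ 0) (hu : IsUnit (1 - t • B))
    (hu' : IsUnit (1 - t • (projPerp e).comp (B.comp (projPerp e))))
    (hR : ⟪e, Ring.inverse (1 - t • B) e⟫ ≠ 0) :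
    HasDerivAt (fun s : ℝ => charProd μ s * (⟪e, Ring.inverse (1 - s • B) e⟫ : ℝ) / charProd ν s)
      0 t := by
  have hF := (hasDerivAt_charProd hμ (isUnit_sub_eigenvalue_ne_zero hB hu)).comp_ofReal
  have hG := (hasDerivAt_charProd hν (isUnit_sub_eigenvalue_ne_zero hC hu')).comp_ofReal
  have hG0 : charProd ν t ≠ 0 := charProd_ne_zero hν fun i => by
    exact_mod_cast isUnit_sub_eigenvalue_ne_zero hC hu' i
  have hR' := (hasDerivAt_inner_inverse hsym hu e).ofReal_comp
  refine ((hF.mul hR').div hG hG0).congr_deriv ?_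
  have h₁ := mul_tsum_sub_tsum hsym he hB hμ hC hν hu hu' hR
  have h₂ := mul_inner_inverse_apply hu e
  set R := ⟪e, Ring.inverse (1 - t • B) e⟫
  set R' := ⟪Ring.inverse (1 - t • B) e, B (Ring.inverse (1 - t • B) e)⟫
  set α := ∑' i, μ i / (1 - t * μ i)
  set β := ∑' i, ν i / (1 - t * ν i)
  have h₃ : (β - α) * R + R' = 0 := by
    refine (mul_eq_zero.1 ?_).resolve_left ht
    field_simp at h₁
    linarith
  have h₄ : ((β : ℂ) - α) * R + R' = 0 := by exact_mod_cast h₃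
  rw [div_eq_zero_iff, Pi.mul_apply]
  left
  linear_combination charProd μ t * charProd ν t * h₄

lemma charProd_mul_inner_inverse_eq (hsym : ∀ f g : H, ⟪B f, g⟫ = ⟪f, B g⟫)
    {e : H} (he : ‖e‖ = 1) (hB : ∀ i, B (b i) = μ i • b i) (hμ : Summable fun i => |μ i|)
    (hC : ∀ i, (projPerp e).comp (B.comp (projPerp e)) (f i) = ν i • f i)
    (hν : Summable fun i => |ν i|) :
    ∀ᶠ t : ℝ in 𝓝[>] 0,
      charProd μ t * (⟪e, Ring.inverse (1 - t • B) e⟫ : ℝ) = charProd ν t := by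
  set C := (projPerp e).comp (B.comp (projPerp e))
  have he0 : e ≠ 0 := by
    rintro rfl
    simp at he
  have hsmall (T : H →L[ℝ] H) : ∀ᶠ t : ℝ in 𝓝 0, |t| * ‖T‖ < 1 := by
    have h : ContinuousAt (fun t : ℝ => |t| * ‖T‖) 0 := by fun_prop
    exact h.eventually_lt continuousAt_const (by simp)
  obtain ⟨r, hr, hball⟩ := Metric.eventually_nhds_iff.1 ((hsmall B).and (hsmall C))
  have hIoo : ∀ t ∈ Set.Ioo 0 r, |t| * ‖B‖ < 1 ∧ |t| * ‖C‖ < 1 := fun t ht =>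
    hball (by rw [Real.dist_eq, sub_zero, abs_of_pos ht.1]; exact ht.2)
  set φ : ℝ → ℂ :=
    fun s => charProd μ s * (⟪e, Ring.inverse (1 - s • B) e⟫ : ℝ) / charProd ν s with hφ
  have hderiv : ∀ t ∈ Set.Ioo 0 r, HasDerivAt φ 0 t := fun t ht =>
    hasDerivAt_charProd_mul_inner_inverse_div hsym he hB hμ hC hν ht.1.ne'
      (isUnit_one_sub_smul (hIoo t ht).1) (isUnit_one_sub_smul (hIoo t ht).2)
      (inner_inverse_pos (hIoo t ht).1 he0).ne'
  obtain ⟨c, hc⟩ := isOpen_Ioo.exists_is_const_of_deriv_eq_zero isPreconnected_Ioo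
    (fun t ht => (hderiv t ht).differentiableAt.differentiableWithinAt)
    (fun t ht => (hderiv t ht).deriv)
  have hmem : Set.Ioo 0 r ∈ 𝓝[>] (0 : ℝ) := Ioo_mem_nhdsGT hr
  have hcont : ContinuousAt φ 0 := by
    have hu : IsUnit (1 - (0 : ℝ) • B) := by simp
    refine ContinuousAt.div (ContinuousAt.mul ?_ ?_) ?_ ?_
    · exact (differentiable_charProd hμ).continuous.continuousAt.comp
        Complex.continuous_ofReal.continuousAt
    · exact (hasDerivAt_inner_inverse hsym hu e).ofReal_comp.continuousAt
    · exact (differentiable_charProd hν).continuous.continuousAt.comp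
        Complex.continuous_ofReal.continuousAt
    · simp [charProd_zero]
  have hφ0 : φ 0 = 1 := by
    simp [hφ, charProd_zero, he]
  have hc1 : c = 1 := by
    rw [← hφ0]
    refine tendsto_nhds_unique (tendsto_const_nhds.congr' ?_)
      (hcont.tendsto.mono_left (nhdsWithin_le_nhds (s := Set.Ioi 0)))
    filter_upwards [hmem] with t ht using (hc t ht).symm
  filter_upwards [hmem] with t ht
  have hG0 : charProd ν t ≠ 0 := charProd_ne_zero hν fun i => by
    exact_mod_cast isUnit_sub_eigenvalue_ne_zero hC (isUnit_one_sub_smul (hIoo t ht).2) i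
  have h := hc t ht
  rwa [hc1, hφ, div_eq_one_iff_eq hG0] at h

/-- Cramer's rule `det(Id - tB) ⟨e, (Id - tB)⁻¹ e⟩ = det(Id - tPBP)`, with both determinants
written as products over given eigenbases. It holds for small `t > 0` by comparing logarithmic
derivatives; both sides extend to entire functions of `t`, hence it holds whenever `Id - tB` is
invertible. -/
theorem tprod_one_sub_mul_inner_inverse (hsym : ∀ f g : H, ⟪B f, g⟫ = ⟪f, B g⟫)
    {e : H} (he : ‖e‖ = 1) (hB : ∀ i, B (b i) = μ i • b i) (hμ : Summable fun i => |μ i|)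
    (hC : ∀ i, (projPerp e).comp (B.comp (projPerp e)) (f i) = ν i • f i)
    (hν : Summable fun i => |ν i|) {t : ℝ} (hu : IsUnit (1 - t • B)) :
    (∏' i, (1 - t * μ i)) * ⟪e, Ring.inverse (1 - t • B) e⟫ = ∏' i, (1 - t * ν i) := by
  have hw : Summable fun i => |⟪b i, e⟫ ^ 2| := (b.hasSum_inner_sq e).summable.abs
  have hS := differentiable_tsum_mul_charProd_update hμ hw
  have hsmall : ∀ᶠ s : ℝ in 𝓝[>] 0, |s| * ‖B‖ < 1 := by
    have h : ContinuousAt (fun s : ℝ => |s| * ‖B‖) 0 := by fun_prop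
    exact nhdsWithin_le_nhds (h.eventually_lt continuousAt_const (by simp))
  have hev : ∀ᶠ s : ℝ in 𝓝[>] 0,
      ∑' i, ((⟪b i, e⟫ ^ 2 : ℝ) : ℂ) * charProd (Function.update μ i 0) s = charProd ν s := by
    filter_upwards [charProd_mul_inner_inverse_eq hsym he hB hμ hC hν, hsmall] with s hs hs'
    rw [tsum_mul_charProd_update_eq hB hμ (isUnit_one_sub_smul hs'), hs]
  have htend : Tendsto (fun s : ℝ => (s : ℂ)) (𝓝[>] 0) (𝓝[≠] ((0 : ℝ) : ℂ)) := by
    refine Complex.continuous_ofReal.continuousAt.continuousWithinAt.tendsto_nhdsWithin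
      fun s hs => ?_
    exact Complex.ofReal_injective.ne (ne_of_gt hs)
  have hall := AnalyticOnNhd.eq_of_frequently_eq
    (fun z _ => hS.analyticAt z) (fun z _ => (differentiable_charProd hν).analyticAt z)
    (htend.frequently hev.frequently)
  have h := congrFun hall (t : ℂ)
  rw [tsum_mul_charProd_update_eq hB hμ hu, charProd_ofReal hμ, charProd_ofReal hν] at h
  exact_mod_cast h

end Cramer

/-- Cramer's rule for Fredholm determinants: for a self-adjoint trace-class `B` with
`Id - B` invertible and a unit vector `e` with `P` the projection onto `e^⊥`,
`⟨e, (Id - B)⁻¹ e⟩ = det(Id - P B P) / det(Id - B)`. -/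
theorem cramer_rule_fredholm
    {H : Type*} [NormedAddCommGroup H] [InnerProductSpace ℝ H] [CompleteSpace H]
    (B : H →L[ℝ] H) (hsym : ∀ f g : H, ⟪B f, g⟫ = ⟪f, B g⟫)
    (htc : IsTraceClassDiag B) (hinv : IsUnit (1 - B))
    (e : H) (he : ‖e‖ = 1) :
    ⟪e, Ring.inverse (1 - B) e⟫
      = fredholmDet ((projPerp e).comp (B.comp (projPerp e))) / fredholmDet B := by
  have htc' := isTraceClassDiag_compression hsym htc he
  have hu : IsUnit (1 - (1 : ℝ) • B) := by rwa [one_smul]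
  have h := tprod_one_sub_mul_inner_inverse hsym he htc.choose_spec.1 htc.choose_spec.2
    htc'.choose_spec.1 htc'.choose_spec.2 hu
  have hne := charProd_ne_zero htc.choose_spec.2 (z := (1 : ℝ)) fun i => by
    exact_mod_cast isUnit_sub_eigenvalue_ne_zero htc.choose_spec.1 hu i
  rw [charProd_ofReal htc.choose_spec.2, Complex.ofReal_ne_zero] at hne
  simp only [one_mul, one_smul] at h hne
  rw [fredholmDet, fredholmDet, dif_pos htc', dif_pos htc, eq_div_iff hne, mul_comm, h]
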